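/- Let p > 3 be a prime and let a be a rational number whose denominator is coprime to p. Then Σ_{k=0}^{p-1} C(-a,k)·C(a-1,k)·H_k ≡ (-1)^{⟨a⟩_p} · 2 · (B_{p-1}(a) − B_{p-1}) (mod p). -/

import Mathlib

open Finset

/-- Generalized binomial coefficient `C(a,k) = a(a-1)⋯(a-k+1)/k!` for a rational `a`. -/
noncomputable def gchoose (a : ℚ) (k : ℕ) : ℚ :=
  (∏ j ∈ Finset.range k, (a - j)) / (Nat.factorial k : ℚ)

/-- The harmonic number `H_k = ∑_{j=1}^k 1/j`. -/
def harm (k : ℕ) : ℚ := ∑ j ∈ Finset.range k, (1 : ℚ) / (j + 1)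

/-- The second-order harmonic number `H_k^{(2)} = ∑_{j=1}^k 1/j²`. -/
def harm2 (k : ℕ) : ℚ := ∑ j ∈ Finset.range k, (1 : ℚ) / (j + 1) ^ 2

/-- `x ≡ y (mod p^m)` for rationals: the p-adic valuation of `x - y` is at least `m`
(with the convention that the valuation of `0` is `+∞`). -/
def CongrMod (p m : ℕ) (x y : ℚ) : Prop :=
  x = y ∨ (m : ℤ) ≤ padicValRat p (x - y)

/-- The Bernoulli polynomial `B_n` evaluated at a rational `x`. -/
noncomputable def bpoly (n : ℕ) (x : ℚ) : ℚ := (Polynomial.bernoulli n).eval x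

/-- The Euler polynomial `E_n` evaluated at a rational `x`, via
`E_n(x) = (2/(n+1))·(B_{n+1}(x) − 2^{n+1}·B_{n+1}(x/2))`. -/
noncomputable def epoly (n : ℕ) (x : ℚ) : ℚ :=
  (2 / (n + 1 : ℚ)) * (bpoly (n + 1) x - 2 ^ (n + 1) * bpoly (n + 1) (x / 2))

/-- The Euler number `E_n = 2^n · E_n(1/2)`. -/
noncomputable def eulerNum (n : ℕ) : ℚ := 2 ^ n * epoly n (1 / 2)

/-- Both rationals are `p`-integral and they agree modulo `p`. -/
structure PadicCongr (p : ℕ) (x y : ℚ) : Prop where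
  left : padicNorm p x ≤ 1
  right : padicNorm p y ≤ 1
  sub_lt : padicNorm p (x - y) < 1

namespace PadicCongr

variable {p : ℕ} {x y z w : ℚ}

theorem refl_of_le (h : padicNorm p x ≤ 1) : PadicCongr p x x :=
  ⟨h, h, by simp⟩

theorem neg (h : PadicCongr p x y) : PadicCongr p (-x) (-y) where
  left := by simpa using h.left
  right := by simpa using h.right
  sub_lt := by
    rw [← neg_sub', padicNorm.neg]
    exact h.sub_lt

theorem symm (h : PadicCongr p x y) : PadicCongr p y x where
  left := h.right
  right := h.left
  sub_lt := by
    rw [← neg_sub, padicNorm.neg]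
    exact h.sub_lt

variable [Fact p.Prime]

theorem natCast (k : ℕ) : PadicCongr p k k :=
  refl_of_le (padicNorm.of_nat k)

theorem one : PadicCongr p 1 1 := by
  simpa using natCast (p := p) 1

theorem add (h : PadicCongr p x y) (h' : PadicCongr p z w) : PadicCongr p (x + z) (y + w) where
  left := padicNorm.nonarchimedean.trans (max_le h.left h'.left)
  right := padicNorm.nonarchimedean.trans (max_le h.right h'.right)
  sub_lt := by
    rw [add_sub_add_comm]
    exact padicNorm.nonarchimedean.trans_lt (max_lt h.sub_lt h'.sub_lt)

theorem sub (h : PadicCongr p x y) (h' : PadicCongr p z w) : PadicCongr p (x - z) (y - w) := by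
  simpa [sub_eq_add_neg] using h.add h'.neg

theorem mul (h : PadicCongr p x y) (h' : PadicCongr p z w) : PadicCongr p (x * z) (y * w) where
  left := by
    rw [padicNorm.mul]
    exact mul_le_one₀ h.left (padicNorm.nonneg _) h'.left
  right := by
    rw [padicNorm.mul]
    exact mul_le_one₀ h.right (padicNorm.nonneg _) h'.right
  sub_lt := by
    have e : x * z - y * w = (x - y) * z + y * (z - w) := by ring
    rw [e]
    refine padicNorm.nonarchimedean.trans_lt (max_lt ?_ ?_) <;> rw [padicNorm.mul]
    · exact mul_lt_one_of_nonneg_of_lt_one_left (padicNorm.nonneg _) h.sub_lt h'.left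
    · exact mul_lt_one_of_nonneg_of_lt_one_right h.right (padicNorm.nonneg _) h'.sub_lt

theorem trans (h : PadicCongr p x y) (h' : PadicCongr p y z) : PadicCongr p x z where
  left := h.left
  right := h'.right
  sub_lt := by
    rw [← sub_add_sub_cancel x y z]
    exact padicNorm.nonarchimedean.trans_lt (max_lt h.sub_lt h'.sub_lt)

theorem pow (h : PadicCongr p x y) (n : ℕ) : PadicCongr p (x ^ n) (y ^ n) := by
  induction n with
  | zero => simpa using one
  | succ n ih => simpa [pow_succ] using ih.mul h

theorem sum {ι : Type*} {s : Finset ι} {f g : ι → ℚ}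
    (h : ∀ i ∈ s, PadicCongr p (f i) (g i)) :
    PadicCongr p (∑ i ∈ s, f i) (∑ i ∈ s, g i) := by
  classical
  induction s using Finset.induction_on with
  | empty => simpa using natCast (p := p) 0
  | insert i s hi ih =>
    rw [Finset.sum_insert hi, Finset.sum_insert hi]
    exact (h i (Finset.mem_insert_self i s)).add
      (ih fun j hj => h j (Finset.mem_insert_of_mem hj))

theorem prod {ι : Type*} {s : Finset ι} {f g : ι → ℚ}
    (h : ∀ i ∈ s, PadicCongr p (f i) (g i)) :
    PadicCongr p (∏ i ∈ s, f i) (∏ i ∈ s, g i) := by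
  classical
  induction s using Finset.induction_on with
  | empty => simpa using one
  | insert i s hi ih =>
    rw [Finset.prod_insert hi, Finset.prod_insert hi]
    exact (h i (Finset.mem_insert_self i s)).mul
      (ih fun j hj => h j (Finset.mem_insert_of_mem hj))

theorem inv_natCast {k : ℕ} (h : ¬ p ∣ k) : PadicCongr p (k : ℚ)⁻¹ (k : ℚ)⁻¹ := by
  refine refl_of_le (le_of_eq ?_)
  rw [← one_div, padicNorm.div, padicNorm.one, (padicNorm.nat_eq_one_iff k).2 h, one_div_one]

theorem inv_natCast_of_lt {k : ℕ} (h0 : 0 < k) (h : k < p) :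
    PadicCongr p (k : ℚ)⁻¹ (k : ℚ)⁻¹ :=
  inv_natCast (Nat.not_dvd_of_pos_of_lt h0 h)

end PadicCongr

theorem congrMod_one_iff_padicNorm_sub_lt {p : ℕ} [hp : Fact p.Prime] {x y : ℚ} :
    CongrMod p 1 x y ↔ padicNorm p (x - y) < 1 := by
  unfold CongrMod
  rcases eq_or_ne x y with rfl | hxy
  · simp
  · rw [padicNorm.eq_zpow_of_nonzero (sub_ne_zero.2 hxy),
      zpow_lt_one_iff_right₀ (by exact_mod_cast hp.out.one_lt)]
    simp only [hxy, false_or]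
    omega

section Congruences

variable {p : ℕ} [hp : Fact p.Prime]

theorem padicCongr_gchoose {a b : ℚ} (h : PadicCongr p a b) {k : ℕ} (hk : k < p) :
    PadicCongr p (gchoose a k) (gchoose b k) := by
  unfold gchoose
  simp only [div_eq_mul_inv]
  refine (PadicCongr.prod fun j _ => h.sub (.natCast j)).mul (.inv_natCast ?_)
  rw [hp.out.dvd_factorial]
  omega

theorem padicCongr_harm {k : ℕ} (hk : k < p) : PadicCongr p (harm k) (harm k) := by
  refine PadicCongr.sum fun j hj => ?_
  have hj := Finset.mem_range.1 hj
  simpa using PadicCongr.inv_natCast_of_lt (p := p) (k := j + 1) (by omega) (by omega)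

theorem padicCongr_bernoulli' (n : ℕ) (hn : n + 1 < p) :
    PadicCongr p (bernoulli' n) (bernoulli' n) := by
  induction n using Nat.strong_induction_on with
  | _ n ih =>
    rw [bernoulli'_def]
    refine PadicCongr.one.sub (PadicCongr.sum fun k hk => ?_)
    have hk := Finset.mem_range.1 hk
    have e : (n : ℚ) - k + 1 = ((n - k + 1 : ℕ) : ℚ) := by
      push_cast [hk.le]
      ring
    rw [e, div_eq_mul_inv]
    exact ((PadicCongr.natCast _).mul (.inv_natCast_of_lt (by omega) (by omega))).mul
      (ih k hk (by omega))

theorem padicCongr_bernoulli (n : ℕ) (hn : n + 1 < p) :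
    PadicCongr p (bernoulli n) (bernoulli n) :=
  (PadicCongr.one.neg.pow n).mul (padicCongr_bernoulli' n hn)

theorem bpoly_sub_bernoulli (n : ℕ) (x : ℚ) :
    bpoly n x - bernoulli n =
      ∑ i ∈ Finset.range n, bernoulli (n - (i + 1)) * n.choose (i + 1) * x ^ (i + 1) := by
  rw [bpoly, Polynomial.bernoulli_def, Polynomial.eval_finsetSum, Finset.sum_range_succ']
  simp

theorem padicCongr_bpoly_sub_bernoulli {a b : ℚ} (h : PadicCongr p a b) :
    PadicCongr p (bpoly (p - 1) a - bernoulli (p - 1)) (bpoly (p - 1) b - bernoulli (p - 1)) := by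
  rw [bpoly_sub_bernoulli, bpoly_sub_bernoulli]
  refine PadicCongr.sum fun i hi => ?_
  have hi := Finset.mem_range.1 hi
  exact ((padicCongr_bernoulli _ (by omega)).mul (.natCast _)).mul (h.pow _)

theorem padicCongr_pow_sub_two {k : ℕ} (h0 : 0 < k) (hk : k < p) :
    PadicCongr p ((k : ℚ) ^ (p - 2)) (k : ℚ)⁻¹ := by
  have hdvd : ¬ p ∣ k := Nat.not_dvd_of_pos_of_lt h0 hk
  have fermat : PadicCongr p ((k : ℚ) ^ (p - 1)) 1 := by
    refine ⟨((PadicCongr.natCast k).pow _).left, PadicCongr.one.left, ?_⟩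
    have hz : (p : ℤ) ∣ (k : ℤ) ^ (p - 1) - 1 := by
      rw [← ZMod.intCast_zmod_eq_zero_iff_dvd]
      push_cast
      rw [ZMod.pow_card_sub_one_eq_one, sub_self]
      rwa [Ne, ZMod.natCast_eq_zero_iff]
    have := (padicNorm.int_lt_one_iff (p := p) _).2 hz
    push_cast at this
    exact this
  have hk0 : (k : ℚ) ≠ 0 := by positivity
  have e : (k : ℚ) ^ (p - 1) * (k : ℚ)⁻¹ = (k : ℚ) ^ (p - 2) := by
    have : p - 1 = p - 2 + 1 := by have := hp.out.two_le; omega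
    rw [this, pow_succ, mul_inv_cancel_right₀ hk0]
  simpa [e] using fermat.mul (.inv_natCast hdvd)

theorem padicCongr_bpoly_natCast_sub_bernoulli (hp2 : 2 < p) {n : ℕ} (hn : n < p) :
    PadicCongr p (bpoly (p - 1) ((n + 1 : ℕ) : ℚ) - bernoulli (p - 1)) (-harm n) := by
  have h := Polynomial.sum_range_pow_eq_bernoulli_sub (n + 1) (p - 2)
  have e : (p - 2).succ = p - 1 := by omega
  rw [e] at h
  rw [bpoly, ← h, harm, Finset.sum_range_succ']
  have hc : PadicCongr p (((p - 2 : ℕ) : ℚ) + 1) (-1) := by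
    refine ⟨((PadicCongr.natCast _).add .one).left, PadicCongr.one.neg.left, ?_⟩
    have : ((p - 2 : ℕ) : ℚ) + 1 - (-1) = p := by
      push_cast [hp2.le]
      ring
    rw [this]
    exact padicNorm.padicNorm_p_lt_one_of_prime
  have hs : PadicCongr p (∑ j ∈ Finset.range n, ((j + 1 : ℕ) : ℚ) ^ (p - 2))
      (∑ j ∈ Finset.range n, (1 : ℚ) / (j + 1)) := by
    refine PadicCongr.sum fun j hj => ?_
    have hj := Finset.mem_range.1 hj
    simpa using padicCongr_pow_sub_two (p := p) (k := j + 1) (by omega) (by omega)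
  have hz : ((0 : ℕ) : ℚ) ^ (p - 2) = 0 := by
    rw [Nat.cast_zero, zero_pow (by omega)]
  rw [hz, add_zero]
  simpa using hc.mul hs

end Congruences

section Identity

theorem gchoose_zero (a : ℚ) : gchoose a 0 = 1 := by
  simp [gchoose]

theorem gchoose_succ (a : ℚ) (k : ℕ) : gchoose a (k + 1) = gchoose a k * (a - k) / (k + 1) := by
  have : (k : ℚ) + 1 ≠ 0 := by positivity
  have : (k.factorial : ℚ) ≠ 0 := by positivity
  rw [gchoose, gchoose, Finset.prod_range_succ, Nat.factorial_succ]
  push_cast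
  field_simp

theorem gchoose_natCast_of_lt {n k : ℕ} (h : n < k) : gchoose n k = 0 := by
  rw [gchoose, Finset.prod_eq_zero (Finset.mem_range.2 h) (sub_self _), zero_div]

theorem harm_succ (k : ℕ) : harm (k + 1) = harm k + 1 / (k + 1) :=
  Finset.sum_range_succ _ _

/-- The summand `C(-a,k) C(a-1,k)`, which is `(-1)^k C(n,k) C(n+k,k)` for `a = n + 1`. -/
noncomputable def legendreTerm (a : ℚ) (k : ℕ) : ℚ := gchoose (-a) k * gchoose (a - 1) k

theorem legendreTerm_zero (a : ℚ) : legendreTerm a 0 = 1 := by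
  simp [legendreTerm, gchoose_zero]

theorem legendreTerm_succ (a : ℚ) (k : ℕ) :
    legendreTerm a (k + 1) = -(legendreTerm a k * (a + k) * (a - 1 - k) / (k + 1) ^ 2) := by
  have : (k : ℚ) + 1 ≠ 0 := by positivity
  rw [legendreTerm, legendreTerm, gchoose_succ, gchoose_succ]
  field_simp
  ring

theorem legendreTerm_natCast_of_lt {n k : ℕ} (h : n < k) :
    legendreTerm ((n + 1 : ℕ) : ℚ) k = 0 := by
  have e : ((n + 1 : ℕ) : ℚ) - 1 = n := by push_cast; ring
  rw [legendreTerm, e, gchoose_natCast_of_lt h, mul_zero]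

theorem legendreTerm_add_one_succ (a : ℚ) (k : ℕ) :
    legendreTerm (a + 1) (k + 1) = -(legendreTerm a k * (a + k) * (a + k + 1) / (k + 1) ^ 2) := by
  induction k with
  | zero =>
    rw [legendreTerm_succ, legendreTerm_zero, legendreTerm_zero]
    simp
    ring
  | succ k ih =>
    have h1 : (k : ℚ) + 1 ≠ 0 := by positivity
    have h2 : (k : ℚ) + 1 + 1 ≠ 0 := by positivity
    rw [legendreTerm_succ, ih, legendreTerm_succ]
    push_cast
    field_simp
    ring

/-- A Wilf–Zeilberger pair for `a ↦ legendreTerm a`. -/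
theorem legendreTerm_add_one_succ_add {a : ℚ} (ha : a ≠ 0) (k : ℕ) :
    legendreTerm (a + 1) (k + 1) + legendreTerm a (k + 1) =
      2 * (a + k + 1) / a * legendreTerm a (k + 1) - 2 * (a + k) / a * legendreTerm a k := by
  have h1 : (k : ℚ) + 1 ≠ 0 := by positivity
  rw [legendreTerm_add_one_succ, legendreTerm_succ]
  field_simp
  ring

theorem sum_legendreTerm_add_one_add {a : ℚ} (ha : a ≠ 0) (N : ℕ) :
    ∑ k ∈ Finset.range (N + 1), (legendreTerm (a + 1) k + legendreTerm a k) =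
      2 * (a + N) / a * legendreTerm a N := by
  induction N with
  | zero =>
    simp [legendreTerm_zero]
    field_simp
    norm_num
  | succ N ih =>
    rw [Finset.sum_range_succ, ih, legendreTerm_add_one_succ_add ha]
    push_cast
    ring

theorem sum_legendreTerm_add_one_add_mul_harm {a : ℚ} (ha : a ≠ 0) (N : ℕ) :
    ∑ k ∈ Finset.range (N + 1), (legendreTerm (a + 1) k + legendreTerm a k) * harm k =
      2 * (a + N) / a * legendreTerm a N * harm (N + 1) -
        ∑ k ∈ Finset.range (N + 1), 2 * (a + k) / a * legendreTerm a k / (k + 1) := by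
  induction N with
  | zero => simp [harm]
  | succ N ih =>
    rw [Finset.sum_range_succ, ih, legendreTerm_add_one_succ_add ha,
      Finset.sum_range_succ _ (N + 1), harm_succ (N + 1)]
    push_cast
    ring

theorem sum_legendreTerm_div {a : ℚ} (ha : a ≠ 0) (N : ℕ) :
    ∑ k ∈ Finset.range N, (a - 1) * (legendreTerm a k / (k + 1)) =
      -(N * legendreTerm a N / a) := by
  induction N with
  | zero => simp
  | succ N ih =>
    have h1 : (N : ℚ) + 1 ≠ 0 := by positivity
    rw [Finset.sum_range_succ, ih, legendreTerm_succ]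
    push_cast
    field_simp
    ring

theorem sum_legendreTerm_natCast {n N : ℕ} (h : n < N) :
    ∑ k ∈ Finset.range N, legendreTerm ((n + 1 : ℕ) : ℚ) k = (-1) ^ n := by
  obtain ⟨N, rfl⟩ : ∃ M, N = M + 1 := ⟨N - 1, by omega⟩
  induction n with
  | zero =>
    rw [Finset.sum_range_succ', legendreTerm_zero, pow_zero, Finset.sum_eq_zero, zero_add]
    exact fun k _ => legendreTerm_natCast_of_lt k.succ_pos
  | succ n ih =>
    have ha : ((n + 1 : ℕ) : ℚ) ≠ 0 := by positivity
    have key := sum_legendreTerm_add_one_add ha N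
    rw [Finset.sum_add_distrib, ih (by omega),
      legendreTerm_natCast_of_lt (by omega : n < N), mul_zero] at key
    rw [Nat.cast_succ (n + 1), pow_succ]
    linarith

theorem sum_legendreTerm_natCast_mul_harm {n N : ℕ} (h : n < N) :
    ∑ k ∈ Finset.range N, legendreTerm ((n + 1 : ℕ) : ℚ) k * harm k = 2 * (-1) ^ n * harm n := by
  obtain ⟨N, rfl⟩ : ∃ M, N = M + 1 := ⟨N - 1, by omega⟩
  induction n with
  | zero =>
    rw [Finset.sum_range_succ', Finset.sum_eq_zero]
    · simp [harm]
    · intro k _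
      rw [legendreTerm_natCast_of_lt k.succ_pos, zero_mul]
  | succ n ih =>
    have ha : ((n + 1 : ℕ) : ℚ) ≠ 0 := by positivity
    have key := sum_legendreTerm_add_one_add_mul_harm ha N
    have hdiv := sum_legendreTerm_div ha (N + 1)
    have hsum := sum_legendreTerm_natCast (by omega : n < N + 1)
    rw [legendreTerm_natCast_of_lt (by omega : n < N + 1), mul_zero, zero_div, neg_zero] at hdiv
    have e : ∀ k : ℕ, 2 * (((n + 1 : ℕ) : ℚ) + k) / ((n + 1 : ℕ) : ℚ) *
        legendreTerm ((n + 1 : ℕ) : ℚ) k / (k + 1) =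
        2 / ((n + 1 : ℕ) : ℚ) * (legendreTerm ((n + 1 : ℕ) : ℚ) k +
          (((n + 1 : ℕ) : ℚ) - 1) * (legendreTerm ((n + 1 : ℕ) : ℚ) k / (k + 1))) := by
      intro k
      have : (k : ℚ) + 1 ≠ 0 := by positivity
      field_simp
      ring
    simp only [e, add_mul] at key
    rw [← Finset.mul_sum, Finset.sum_add_distrib, Finset.sum_add_distrib, hdiv, hsum,
      ih (by omega), legendreTerm_natCast_of_lt (by omega : n < N)] at key
    rw [Nat.cast_succ (n + 1), harm_succ, pow_succ]
    push_cast at key ⊢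
    linear_combination key

end Identity

theorem stmt_2 (p : ℕ) (hp : p.Prime) (hp3 : 3 < p) (a : ℚ) (ha : ¬ (p ∣ a.den))
    (r : ℕ) (hr : r < p) (har : CongrMod p 1 a r) :
    CongrMod p 1
      (∑ k ∈ Finset.range p, gchoose (-a) k * gchoose (a - 1) k * harm k)
      ((-1 : ℚ) ^ r * 2 * (bpoly (p - 1) a - bernoulli (p - 1))) := by
  have : Fact p.Prime := ⟨hp⟩
  rw [congrMod_one_iff_padicNorm_sub_lt] at har ⊢
  have hle : padicNorm p a ≤ 1 := by
    rw [← sub_add_cancel a r]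
    exact padicNorm.nonarchimedean.trans (max_le har.le (padicNorm.of_nat r))
  have hcongr : PadicCongr p a r := ⟨hle, padicNorm.of_nat r, har⟩
  have hleft : PadicCongr p (∑ k ∈ Finset.range p, gchoose (-a) k * gchoose (a - 1) k * harm k)
      (∑ k ∈ Finset.range p, legendreTerm r k * harm k) := by
    refine PadicCongr.sum fun k hk => ?_
    have hk := Finset.mem_range.1 hk
    exact ((padicCongr_gchoose hcongr.neg hk).mul
      (padicCongr_gchoose (hcongr.sub .one) hk)).mul (padicCongr_harm hk)
  have hsign : PadicCongr p ((-1 : ℚ) ^ r * 2) ((-1) ^ r * 2) := by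
    simpa using (PadicCongr.one.neg.pow r).mul (.natCast (p := p) 2)
  have hright := hsign.mul (padicCongr_bpoly_sub_bernoulli hcongr)
  refine (hleft.trans (PadicCongr.trans ?_ hright.symm)).sub_lt
  cases r with
  | zero =>
    have e : ∑ k ∈ Finset.range p, legendreTerm ((0 : ℕ) : ℚ) k * harm k = 0 := by
      refine Finset.sum_eq_zero fun k _ => ?_
      cases k with
      | zero => simp [harm]
      | succ k => simp [legendreTerm, gchoose, Finset.prod_range_succ']
    rw [e]
    simpa [bpoly] using PadicCongr.natCast (p := p) 0
  | succ n =>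
    rw [sum_legendreTerm_natCast_mul_harm (by omega : n < p)]
    have h := hsign.mul
      (padicCongr_bpoly_natCast_sub_bernoulli (by omega) (by omega : n < p)).symm
    have e : (-1 : ℚ) ^ (n + 1) * 2 * -harm n = 2 * (-1) ^ n * harm n := by ring
    rwa [e] at h
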